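/- Let α ∈ (0, 1/2), for each positive integer n let t_n* ∈ (0, n) be the unique solution of P_n(t_n*) = α. Then as n → ∞, (1/n)·log V_n(t_n*) = h_max(α) − (log n)/(2n) + ω_α/n + o(1/n), where ω_α = 1 − (1/2)·log( 2π( −μ* + 2αμ* + (μ*)²·α·(1−α) ) ). Equivalently, the logarithm of the maximum shaping gain satisfies log( V_n(t_n*)^{1/n} / (2α) ) = h_max(α) − log(2α) − (log n)/(2n) + ω_α/n + o(1/n). -/

import Mathlib

open MeasureTheory Filter Asymptotics Real

/-- The truncated cube `𝒯_n(t) = {x ∈ [0,1]^n : ∑ i, x i ≤ t}`. -/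
def truncCube (n : ℕ) (t : ℝ) : Set (Fin n → ℝ) :=
  {x | (∀ i, x i ∈ Set.Icc (0 : ℝ) 1) ∧ ∑ i, x i ≤ t}

/-- Volume of the truncated cube. -/
noncomputable def truncVol (n : ℕ) (t : ℝ) : ℝ :=
  (volume (truncCube n t)).toReal

/-- Average first moment of the truncated cube. -/
noncomputable def truncMoment (n : ℕ) (t : ℝ) : ℝ :=
  (1 / (n * truncVol n t)) * ∫ x in truncCube n t, ∑ i, x i


open scoped Topology FourierTransform

/-- The Gamma-type kernel `v₊ e^{-μ v}`. -/
noncomputable def rampExp (μ v : ℝ) : ℝ := max v 0 * Real.exp (-μ * v)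

/-- The Fourier transform of `rampExp μ`. -/
noncomputable def rampExpFourier (μ ξ : ℝ) : ℂ := ((μ + (2 * π * ξ : ℝ) * Complex.I) ^ 2)⁻¹

lemma continuous_rampExp (μ : ℝ) : Continuous (rampExp μ) := by
  unfold rampExp; fun_prop

lemma rampExp_eq_indicator (μ : ℝ) :
    rampExp μ = (Set.Ioi 0).indicator (fun v => v * Real.exp (-μ * v)) := by
  ext v
  by_cases hv : 0 < v
  · simp [rampExp, Set.indicator, hv, hv.le]
  · simp [rampExp, Set.indicator, hv, not_lt.1 hv]

lemma integrable_rampExp {μ : ℝ} (hμ : 0 < μ) : Integrable (rampExp μ) := by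
  rw [rampExp_eq_indicator, integrable_indicator_iff measurableSet_Ioi]
  have := integrableOn_rpow_mul_exp_neg_mul_rpow (p := 1) (s := 1) (b := μ) (by norm_num) one_pos hμ
  simpa using this

lemma add_mul_I_ne_zero {μ : ℝ} (hμ : 0 < μ) (y : ℝ) : (μ + y * Complex.I : ℂ) ≠ 0 := by
  intro h
  have := congrArg Complex.re h
  simp at this
  exact hμ.ne' this

lemma norm_rampExpFourier {μ : ℝ} (ξ : ℝ) :
    ‖rampExpFourier μ ξ‖ = (μ ^ 2 + (2 * π * ξ) ^ 2)⁻¹ := by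
  rw [rampExpFourier, norm_inv, norm_pow, Complex.sq_norm, Complex.normSq_add_mul_I]

lemma continuous_rampExpFourier {μ : ℝ} (hμ : 0 < μ) : Continuous (rampExpFourier μ) := by
  unfold rampExpFourier
  refine Continuous.inv₀ (by fun_prop) fun ξ => pow_ne_zero 2 ?_
  exact add_mul_I_ne_zero hμ _

lemma integrable_inv_sq_add_sq {μ : ℝ} (hμ : 0 < μ) {b : ℝ} (hb : b ≠ 0) :
    Integrable (fun ξ : ℝ => (μ ^ 2 + (b * ξ) ^ 2)⁻¹) := by
  have h := (integrable_inv_one_add_sq.comp_mul_left' (R := b / μ) (by positivity)).const_mul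
    (μ ^ 2)⁻¹
  refine h.congr (Eventually.of_forall fun ξ => ?_)
  simp only
  rw [← mul_inv]
  congr 1
  field_simp

lemma integrable_rampExpFourier {μ : ℝ} (hμ : 0 < μ) : Integrable (rampExpFourier μ) := by
  rw [← integrable_norm_iff (continuous_rampExpFourier hμ).aestronglyMeasurable]
  simp_rw [norm_rampExpFourier]
  exact integrable_inv_sq_add_sq hμ (by positivity)

lemma integral_Ioi_id_mul_cexp {z : ℂ} (hz : 0 < z.re) :
    ∫ v in Set.Ioi (0 : ℝ), (v : ℂ) * Complex.exp (-z * v) = (z ^ 2)⁻¹ := by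
  have hz0 : z ≠ 0 := by rintro rfl; simp at hz
  have hnorm : ∀ v : ℝ, ‖Complex.exp (-z * v)‖ = Real.exp (-z.re * v) := by
    intro v; rw [Complex.norm_exp]; simp
  have hint : IntegrableOn (fun v : ℝ => (v : ℂ) * Complex.exp (-z * v)) (Set.Ioi 0) := by
    have h := (integrable_rampExp hz)
    rw [rampExp_eq_indicator, integrable_indicator_iff measurableSet_Ioi] at h
    refine h.mono' (by fun_prop) ?_
    filter_upwards [ae_restrict_mem measurableSet_Ioi] with v hv
    rw [norm_mul, hnorm, Complex.norm_real, Real.norm_of_nonneg (le_of_lt hv)]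
  have hderiv : ∀ v : ℝ, HasDerivAt
      (fun v : ℝ => -((v : ℂ) / z + (z ^ 2)⁻¹) * Complex.exp (-z * v))
      ((v : ℂ) * Complex.exp (-z * v)) v := by
    intro v
    have h1 : HasDerivAt (fun v : ℝ => (v : ℂ)) 1 v := Complex.ofRealCLM.hasDerivAt
    have h2 := ((h1.div_const z).add_const ((z ^ 2)⁻¹)).neg.mul (h1.const_mul (-z)).cexp
    refine h2.congr_deriv ?_
    simp only [Pi.neg_apply]
    field_simp
    ring
  have hlim : Tendsto (fun v : ℝ => -((v : ℂ) / z + (z ^ 2)⁻¹) * Complex.exp (-z * v))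
      atTop (𝓝 0) := by
    rw [tendsto_zero_iff_norm_tendsto_zero]
    have h1 := Real.tendsto_pow_mul_exp_neg_atTop_nhds_zero 1
    have hb : Tendsto (fun v : ℝ => z.re * v) atTop atTop := tendsto_id.const_mul_atTop hz
    have h2 := (h1.comp hb).const_mul (‖z‖⁻¹ * z.re⁻¹)
    have h3 := ((Real.tendsto_exp_neg_atTop_nhds_zero).comp hb).const_mul (‖z ^ 2‖⁻¹)
    have h4 := h2.add h3
    simp only [mul_zero, add_zero] at h4
    refine squeeze_zero' (Eventually.of_forall fun v => norm_nonneg _) ?_ h4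
    filter_upwards [eventually_ge_atTop 0] with v hv
    rw [norm_mul, hnorm, norm_neg]
    have : ‖(v : ℂ) / z + (z ^ 2)⁻¹‖ ≤ v * ‖z‖⁻¹ + ‖z ^ 2‖⁻¹ := by
      refine (norm_add_le _ _).trans_eq ?_
      rw [norm_div, norm_inv, Complex.norm_real, Real.norm_of_nonneg hv, div_eq_mul_inv]
    refine (mul_le_mul_of_nonneg_right this (Real.exp_nonneg _)).trans_eq ?_
    simp only [Function.comp, pow_one, neg_mul]
    field_simp
  have := integral_Ioi_of_hasDerivAt_of_tendsto' (a := 0) (fun v _ => hderiv v) hint hlim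
  rw [this]
  simp

lemma fourier_rampExp {μ : ℝ} (hμ : 0 < μ) :
    𝓕 (fun v => (rampExp μ v : ℂ)) = rampExpFourier μ := by
  ext ξ
  rw [fourier_real_eq_integral_exp_smul]
  have hz : 0 < (μ + (2 * π * ξ : ℝ) * Complex.I : ℂ).re := by simpa using hμ
  rw [rampExpFourier, ← integral_Ioi_id_mul_cexp hz, ← integral_indicator measurableSet_Ioi]
  congr 1
  ext v
  rw [rampExp_eq_indicator]
  by_cases hv : v ∈ Set.Ioi (0 : ℝ)
  · simp only [Set.indicator_of_mem hv, smul_eq_mul]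
    push_cast
    rw [mul_left_comm, ← Complex.exp_add]
    ring_nf
  · simp [Set.indicator_of_notMem hv]

lemma rampExp_eq_integral {μ : ℝ} (hμ : 0 < μ) (v : ℝ) :
    (rampExp μ v : ℂ) =
      ∫ ξ : ℝ, Complex.exp ((2 * π * ξ * v : ℝ) * Complex.I) * rampExpFourier μ ξ := by
  have h := (Complex.continuous_ofReal.comp (continuous_rampExp μ)).fourierInv_fourier_eq
    (integrable_rampExp hμ).ofReal (by
      have := integrable_rampExpFourier hμ
      rwa [← fourier_rampExp hμ] at this)
  have h' := congrFun h v
  simp only [Function.comp_def] at h'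
  rw [← h', Real.fourierInv_eq']
  refine integral_congr_ae (Eventually.of_forall fun ξ => ?_)
  simp only [smul_eq_mul, fourier_rampExp hμ]
  congr 3
  simp
  ring

/-- The density `(μ / (1 - e^{-μ})) e^{-μ x}` of the truncated exponential law on `[0, 1]`. -/
noncomputable def truncExpDensity (μ x : ℝ) : ℝ := μ / (1 - Real.exp (-μ)) * Real.exp (-μ * x)

/-- The variance of the truncated exponential law on `[0, 1]`. -/
noncomputable def truncExpVariance (μ : ℝ) : ℝ :=
  1 / μ ^ 2 - Real.exp (-μ) / (1 - Real.exp (-μ)) ^ 2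

/-- The characteristic function of the truncated exponential law, recentred at `α`. -/
noncomputable def truncExpCharFun (μ α s : ℝ) : ℂ :=
  ∫ x in Set.Icc (0 : ℝ) 1, Complex.exp ((s * (x - α) : ℝ) * Complex.I) * truncExpDensity μ x

lemma continuous_truncExpDensity (μ : ℝ) : Continuous (truncExpDensity μ) := by
  unfold truncExpDensity; fun_prop

lemma one_sub_exp_neg_pos {μ : ℝ} (hμ : 0 < μ) : 0 < 1 - Real.exp (-μ) := by
  have : Real.exp (-μ) < 1 := by simpa using hμ
  linarith

lemma truncExpDensity_pos {μ : ℝ} (hμ : 0 < μ) (x : ℝ) : 0 < truncExpDensity μ x :=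
  mul_pos (div_pos hμ (one_sub_exp_neg_pos hμ)) (Real.exp_pos _)

lemma truncExpVariance_pos {μ : ℝ} (hμ : 0 < μ) : 0 < truncExpVariance μ := by
  have h1 : μ / 2 < Real.sinh (μ / 2) := Real.self_lt_sinh_iff.2 (by positivity)
  rw [Real.sinh_eq] at h1
  have hE : Real.exp (-μ) = Real.exp (-(μ / 2)) ^ 2 := by
    rw [← Real.exp_nat_mul]; congr 1; push_cast; ring
  have hm : Real.exp (μ / 2) * Real.exp (-(μ / 2)) = 1 := by rw [← Real.exp_add]; simp
  have hF := Real.exp_pos (-(μ / 2))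
  have hd := one_sub_exp_neg_pos hμ
  rw [truncExpVariance, sub_pos, div_lt_div_iff₀ (by positivity) (by positivity), one_mul]
  have h2 : μ * Real.exp (-(μ / 2)) < 1 - Real.exp (-μ) := by
    rw [hE]; nlinarith
  calc Real.exp (-μ) * μ ^ 2 = (μ * Real.exp (-(μ / 2))) ^ 2 := by rw [hE]; ring
    _ < _ := by gcongr

lemma sq_mul_truncExpVariance {μ α : ℝ} (hμ : 0 < μ) (hα : α = 1 / μ - 1 / (Real.exp μ - 1)) :
    μ ^ 2 * truncExpVariance μ = -μ + 2 * α * μ + μ ^ 2 * α * (1 - α) := by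
  have hd := (one_sub_exp_neg_pos hμ).ne'
  have he : Real.exp μ - 1 ≠ 0 := by
    have : 1 < Real.exp μ := by simpa using hμ
    linarith
  rw [truncExpVariance, hα]
  rw [Real.exp_neg] at *
  have := (Real.exp_pos μ).ne'
  have hd' : 1 - (Real.exp μ)⁻¹ = (Real.exp μ - 1) / Real.exp μ := by field_simp
  rw [hd']
  field_simp
  ring

lemma setIntegral_Icc_eq_sub {E : Type*} [NormedAddCommGroup E] [NormedSpace ℝ E] [CompleteSpace E]
    {F f : ℝ → E} (h : ∀ x, HasDerivAt F (f x) x) (hf : Continuous f) :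
    ∫ x in Set.Icc (0 : ℝ) 1, f x = F 1 - F 0 := by
  rw [integral_Icc_eq_integral_Ioc, ← intervalIntegral.integral_of_le zero_le_one]
  exact intervalIntegral.integral_eq_sub_of_hasDerivAt (fun x _ => h x)
    (hf.intervalIntegrable _ _)

lemma hasDerivAt_exp_neg_mul (μ x : ℝ) :
    HasDerivAt (fun x : ℝ => Real.exp (-μ * x)) (-μ * Real.exp (-μ * x)) x := by
  have := ((hasDerivAt_id x).const_mul (-μ)).exp
  refine this.congr_deriv ?_
  simp; ring

lemma integral_truncExpDensity {μ : ℝ} (hμ : 0 < μ) :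
    ∫ x in Set.Icc (0 : ℝ) 1, truncExpDensity μ x = 1 := by
  have hd := (one_sub_exp_neg_pos hμ).ne'
  rw [setIntegral_Icc_eq_sub (F := fun x => -(1 / (1 - Real.exp (-μ))) * Real.exp (-μ * x)) _
    (continuous_truncExpDensity μ)]
  · simp; field_simp; ring
  · intro x
    refine ((hasDerivAt_exp_neg_mul μ x).const_mul _).congr_deriv ?_
    rw [truncExpDensity]; ring

lemma truncExp_mean_eq {μ α : ℝ} (hμ : 0 < μ) (hα : α = 1 / μ - 1 / (Real.exp μ - 1)) :
    α = 1 / μ - Real.exp (-μ) / (1 - Real.exp (-μ)) := by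
  have he : Real.exp μ - 1 ≠ 0 := by
    have : 1 < Real.exp μ := by simpa using hμ
    linarith
  have hd := (one_sub_exp_neg_pos hμ).ne'
  rw [hα, Real.exp_neg] at *
  have := (Real.exp_pos μ).ne'
  have hd' : 1 - (Real.exp μ)⁻¹ = (Real.exp μ - 1) / Real.exp μ := by field_simp
  rw [hd']
  field_simp

lemma integral_sub_mul_truncExpDensity {μ α : ℝ} (hμ : 0 < μ)
    (hα : α = 1 / μ - 1 / (Real.exp μ - 1)) :
    ∫ x in Set.Icc (0 : ℝ) 1, (x - α) * truncExpDensity μ x = 0 := by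
  have hd := (one_sub_exp_neg_pos hμ).ne'
  have hα' := truncExp_mean_eq hμ hα
  rw [setIntegral_Icc_eq_sub (F := fun x => -(1 / (1 - Real.exp (-μ))) *
      (((x - α) + 1 / μ) * Real.exp (-μ * x))) _
    (by have := continuous_truncExpDensity μ; fun_prop)]
  · rw [hα']; simp; field_simp; ring
  · intro x
    refine (((((hasDerivAt_id x).sub_const α).add_const (1 / μ)).mul
      (hasDerivAt_exp_neg_mul μ x)).const_mul _).congr_deriv ?_
    rw [truncExpDensity]; simp; field_simp; ring

lemma integral_sub_sq_mul_truncExpDensity {μ α : ℝ} (hμ : 0 < μ)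
    (hα : α = 1 / μ - 1 / (Real.exp μ - 1)) :
    ∫ x in Set.Icc (0 : ℝ) 1, (x - α) ^ 2 * truncExpDensity μ x = truncExpVariance μ := by
  have hd := (one_sub_exp_neg_pos hμ).ne'
  have hα' := truncExp_mean_eq hμ hα
  rw [setIntegral_Icc_eq_sub (F := fun x => -(1 / (1 - Real.exp (-μ))) *
      (((x - α) ^ 2 + 2 / μ * (x - α) + 2 / μ ^ 2) * Real.exp (-μ * x))) _
    (by have := continuous_truncExpDensity μ; fun_prop)]
  · rw [hα', truncExpVariance]; simp; field_simp; ring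
  · intro x
    have h1 := (hasDerivAt_id x).sub_const α
    refine (((((h1.pow 2).add (h1.const_mul (2 / μ))).add_const (2 / μ ^ 2)).mul
      (hasDerivAt_exp_neg_mul μ x)).const_mul _).congr_deriv ?_
    rw [truncExpDensity]; simp; field_simp; ring

lemma truncExpCharFun_eq {μ : ℝ} (hμ : 0 < μ) (α s : ℝ) :
    truncExpCharFun μ α s = Complex.exp ((-(s * α) : ℝ) * Complex.I) *
      ((μ / (1 - Real.exp (-μ)) : ℝ) *
        ((Complex.exp (-μ + s * Complex.I) - 1) / (-μ + s * Complex.I))) := by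
  have hz : (-μ + s * Complex.I : ℂ) ≠ 0 := by
    intro h
    have := congrArg Complex.re h
    simp at this
    exact hμ.ne' this
  rw [truncExpCharFun, setIntegral_Icc_eq_sub (F := fun x : ℝ =>
    Complex.exp ((-(s * α) : ℝ) * Complex.I) * ((μ / (1 - Real.exp (-μ)) : ℝ) *
      (Complex.exp ((-μ + s * Complex.I) * x) / (-μ + s * Complex.I))))]
  · simp; ring
  · intro x
    have h1 : HasDerivAt (fun v : ℝ => (v : ℂ)) 1 x := Complex.ofRealCLM.hasDerivAt
    refine (((((h1.const_mul (-μ + s * Complex.I)).cexp).div_const _).const_mul _).const_mul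
      _).congr_deriv ?_
    rw [truncExpDensity]
    have : Complex.exp ((s * (x - α) : ℝ) * Complex.I) * (Real.exp (-μ * x) : ℝ) =
      Complex.exp ((-(s * α) : ℝ) * Complex.I) * Complex.exp ((-μ + s * Complex.I) * x) := by
      rw [Complex.ofReal_exp, ← Complex.exp_add, ← Complex.exp_add]
      congr 1
      push_cast; ring
    rw [Complex.ofReal_mul (μ / (1 - Real.exp (-μ))), 
      mul_left_comm (Complex.exp ((s * (x - α) : ℝ) * Complex.I)), this, mul_one,
      mul_div_assoc, div_self hz]
    ring
  · have := continuous_truncExpDensity μ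
    fun_prop

lemma continuous_truncExpCharFun {μ : ℝ} (hμ : 0 < μ) (α : ℝ) :
    Continuous (truncExpCharFun μ α) := by
  have h : ∀ s : ℝ, (-μ + s * Complex.I : ℂ) ≠ 0 := by
    intro s h
    have := congrArg Complex.re h
    simp at this
    exact hμ.ne' this
  rw [show truncExpCharFun μ α = _ from funext (truncExpCharFun_eq hμ α)]
  have : Continuous fun s : ℝ => (Complex.exp (-μ + s * Complex.I) - 1) / (-μ + s * Complex.I) :=
    Continuous.div (by fun_prop) (by fun_prop) h
  fun_prop

lemma norm_sq_truncExpCharFun {μ : ℝ} (hμ : 0 < μ) (α s : ℝ) :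
    ‖truncExpCharFun μ α s‖ ^ 2 =
      (μ / (1 - Real.exp (-μ))) ^ 2 *
        ((Real.exp (-μ) ^ 2 - 2 * Real.exp (-μ) * Real.cos s + 1) / (μ ^ 2 + s ^ 2)) := by
  rw [truncExpCharFun_eq hμ, norm_mul, Complex.norm_exp_ofReal_mul_I, one_mul, norm_mul, mul_pow,
    Complex.norm_real, Real.norm_eq_abs, sq_abs, norm_div,
    div_pow ‖Complex.exp (-μ + s * Complex.I) - 1‖]
  have h1 : ‖(-μ + s * Complex.I : ℂ)‖ ^ 2 = μ ^ 2 + s ^ 2 := by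
    rw [← Complex.ofReal_neg, Complex.sq_norm, Complex.normSq_add_mul_I]; ring
  have h2 : ‖Complex.exp (-μ + s * Complex.I) - 1‖ ^ 2 =
      Real.exp (-μ) ^ 2 - 2 * Real.exp (-μ) * Real.cos s + 1 := by
    rw [Complex.exp_add, Complex.exp_mul_I, ← Complex.ofReal_neg, ← Complex.ofReal_exp,
      ← Complex.ofReal_cos, ← Complex.ofReal_sin, Complex.sq_norm, Complex.normSq_apply]
    simp only [Complex.sub_re, Complex.sub_im, Complex.mul_re, Complex.mul_im, Complex.add_re,
      Complex.add_im, Complex.ofReal_re, Complex.ofReal_im, Complex.I_re, Complex.I_im,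
      Complex.one_re, Complex.one_im]
    linear_combination Real.exp (-μ) ^ 2 * Real.sin_sq_add_cos_sq s
  rw [h1, h2]

lemma norm_sq_truncExpCharFun_le {μ : ℝ} (hμ : 0 < μ) (α s : ℝ) :
    ‖truncExpCharFun μ α s‖ ^ 2 ≤ 1 - truncExpVariance μ * μ ^ 2 * (s ^ 2 / (μ ^ 2 + s ^ 2)) := by
  rw [norm_sq_truncExpCharFun hμ, truncExpVariance]
  have hd := one_sub_exp_neg_pos hμ
  have hcos := Real.one_sub_sq_div_two_le_cos (x := s)
  have hE := Real.exp_pos (-μ)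
  set E := Real.exp (-μ)
  have hs : 0 < μ ^ 2 + s ^ 2 := by positivity
  have hle : E ^ 2 - 2 * E * Real.cos s + 1 ≤ (1 - E) ^ 2 + E * s ^ 2 := by nlinarith
  calc _ ≤ (μ / (1 - E)) ^ 2 * (((1 - E) ^ 2 + E * s ^ 2) / (μ ^ 2 + s ^ 2)) := by gcongr
    _ = _ := by field_simp; ring

lemma exists_norm_truncExpCharFun_le {μ : ℝ} (hμ : 0 < μ) (α : ℝ) :
    ∃ k > 0, ∀ s, ‖truncExpCharFun μ α s‖ ≤ Real.exp (-k * min (s ^ 2) 1) := by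
  have hv := truncExpVariance_pos hμ
  refine ⟨truncExpVariance μ * μ ^ 2 / (2 * (μ ^ 2 + 1)), by positivity, fun s => ?_⟩
  refine (sq_le_sq₀ (norm_nonneg _) (Real.exp_nonneg _)).1 ?_
  rw [← Real.exp_nat_mul]
  refine (norm_sq_truncExpCharFun_le hμ α s).trans ?_
  have h1 : min (s ^ 2) 1 / (μ ^ 2 + 1) ≤ s ^ 2 / (μ ^ 2 + s ^ 2) := by
    rcases eq_or_ne s 0 with rfl | hs
    · simp
    rw [div_le_div_iff₀ (by positivity) (by positivity)]
    rcases le_total (s ^ 2) 1 with h | h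
    · rw [min_eq_left h]; gcongr
    · rw [min_eq_right h]; nlinarith [sq_nonneg μ]
  have h2 := mul_le_mul_of_nonneg_left h1 (by positivity : 0 ≤ truncExpVariance μ * μ ^ 2)
  refine le_trans ?_ (Real.add_one_le_exp _)
  have h3 : ((2 : ℕ) : ℝ) * (-(truncExpVariance μ * μ ^ 2 / (2 * (μ ^ 2 + 1))) * min (s ^ 2) 1) =
    -(truncExpVariance μ * μ ^ 2 * (min (s ^ 2) 1 / (μ ^ 2 + 1))) := by
    push_cast; field_simp
  rw [h3]
  linarith

lemma norm_truncExpCharFun_pow_le {μ α k : ℝ}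
    (h : ∀ s, ‖truncExpCharFun μ α s‖ ≤ Real.exp (-k * min (s ^ 2) 1)) (s : ℝ) (n : ℕ) :
    ‖truncExpCharFun μ α s‖ ^ n ≤ Real.exp (-k * (n * s ^ 2)) + Real.exp (-k * n) := by
  have h1 := pow_le_pow_left₀ (norm_nonneg _) (h s) n
  rw [← Real.exp_nat_mul] at h1
  refine h1.trans ?_
  rcases le_total (s ^ 2) 1 with h | h
  · rw [min_eq_left h]
    refine le_add_of_le_of_nonneg (le_of_eq ?_) (Real.exp_nonneg _)
    congr 1; ring
  · rw [min_eq_right h]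
    refine le_add_of_nonneg_of_le (Real.exp_nonneg _) (le_of_eq ?_)
    congr 1; ring

/-- The truncated exponential law on `[0, 1]`. -/
noncomputable def truncExpMeasure (μ : ℝ) : Measure ℝ :=
  (volume.restrict (Set.Icc (0 : ℝ) 1)).withDensity fun x => ENNReal.ofReal (truncExpDensity μ x)

lemma integral_truncExpMeasure {E : Type*} [NormedAddCommGroup E] [NormedSpace ℝ E]
    {μ : ℝ} (hμ : 0 < μ) (f : ℝ → E) :
    ∫ x, f x ∂truncExpMeasure μ = ∫ x in Set.Icc (0 : ℝ) 1, truncExpDensity μ x • f x := by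
  rw [truncExpMeasure, integral_withDensity_eq_integral_toReal_smul
    (by have := continuous_truncExpDensity μ; fun_prop) (by simp)]
  simp_rw [ENNReal.toReal_ofReal (truncExpDensity_pos hμ _).le]

lemma integrableOn_truncExpDensity (μ : ℝ) :
    Integrable (truncExpDensity μ) (volume.restrict (Set.Icc (0 : ℝ) 1)) :=
  (continuous_truncExpDensity μ).continuousOn.integrableOn_Icc

lemma isProbabilityMeasure_truncExpMeasure {μ : ℝ} (hμ : 0 < μ) :
    IsProbabilityMeasure (truncExpMeasure μ) := by
  constructor
  rw [truncExpMeasure, withDensity_apply _ MeasurableSet.univ, Measure.restrict_univ,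
    ← ofReal_integral_eq_lintegral_ofReal (integrableOn_truncExpDensity μ)
      (Eventually.of_forall fun x => (truncExpDensity_pos hμ x).le),
    integral_truncExpDensity hμ, ENNReal.ofReal_one]

lemma charFun_truncExpMeasure_map {μ : ℝ} (hμ : 0 < μ) (α σ t : ℝ) :
    charFun ((truncExpMeasure μ).map fun x => (x - α) / σ) t = truncExpCharFun μ α (t / σ) := by
  rw [charFun_apply_real, integral_map (by fun_prop) (by fun_prop), integral_truncExpMeasure hμ,
    truncExpCharFun]
  congr 1
  ext x
  rw [Complex.real_smul, mul_comm]
  congr 3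
  push_cast
  ring

lemma tendsto_truncExpCharFun_pow {μ α : ℝ} (hμ : 0 < μ)
    (hα : α = 1 / μ - 1 / (Real.exp μ - 1)) (t : ℝ) :
    Tendsto (fun n : ℕ => truncExpCharFun μ α ((√n)⁻¹ * t / √(truncExpVariance μ)) ^ n) atTop
      (𝓝 (Complex.exp (-t ^ 2 / 2))) := by
  have hv := truncExpVariance_pos hμ
  have := isProbabilityMeasure_truncExpMeasure hμ
  simp_rw [← charFun_truncExpMeasure_map hμ]
  apply ProbabilityTheory.tendsto_charFun_inv_sqrt_mul_pow
  · fun_prop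
  · rw [integral_truncExpMeasure hμ]
    have h := integral_sub_mul_truncExpDensity hμ hα
    calc _ = ∫ x in Set.Icc (0 : ℝ) 1,
          (x - α) * truncExpDensity μ x / √(truncExpVariance μ) := by
          congr 1; ext x; rw [smul_eq_mul]; ring
      _ = 0 := by rw [integral_div, h, zero_div]
  · rw [integral_truncExpMeasure hμ]
    have h := integral_sub_sq_mul_truncExpDensity hμ hα
    calc _ = ∫ x in Set.Icc (0 : ℝ) 1,
          (x - α) ^ 2 * truncExpDensity μ x / truncExpVariance μ := by
          congr 1; ext x; simp only [Pi.pow_apply]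
          rw [smul_eq_mul, div_pow, Real.sq_sqrt hv.le]; ring
      _ = 1 := by rw [integral_div, h, div_self hv.ne']

/-- Fubini and Fourier inversion turn the smoothed partial-sum integral into a one-dimensional
integral against a power of the characteristic function. -/
lemma integral_rampExp_pi {μ : ℝ} (hμ : 0 < μ) (α δ : ℝ) (n : ℕ) :
    ((∫ x : Fin n → ℝ, rampExp μ (n * α + δ - ∑ i, x i) * ∏ i, truncExpDensity μ (x i)
        ∂Measure.pi fun _ => volume.restrict (Set.Icc (0 : ℝ) 1) : ℝ) : ℂ) =
      ∫ ξ : ℝ, Complex.exp ((2 * π * ξ * δ : ℝ) * Complex.I) * rampExpFourier μ ξ *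
        truncExpCharFun μ α (-(2 * π * ξ)) ^ n := by
  have hp := continuous_truncExpDensity μ
  have hR := continuous_rampExpFourier hμ
  set ρ : Measure (Fin n → ℝ) := Measure.pi fun _ => volume.restrict (Set.Icc (0 : ℝ) 1) with hρ
  have hprod : Integrable (fun x : Fin n → ℝ => ∏ i, truncExpDensity μ (x i)) ρ :=
    Integrable.fintype_prod fun _ => integrableOn_truncExpDensity μ
  have hint : Integrable (Function.uncurry fun (x : Fin n → ℝ) (ξ : ℝ) =>
      Complex.exp ((2 * π * ξ * (n * α + δ - ∑ i, x i) : ℝ) * Complex.I) * rampExpFourier μ ξ *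
        ((∏ i, truncExpDensity μ (x i) : ℝ) : ℂ)) (ρ.prod volume) := by
    refine (hprod.mul_prod (integrable_rampExpFourier hμ).norm).mono' ?_ ?_
    · refine Continuous.aestronglyMeasurable ?_
      unfold Function.uncurry
      fun_prop
    · refine Eventually.of_forall fun z => ?_
      simp only [Function.uncurry]
      rw [norm_mul, norm_mul, Complex.norm_exp_ofReal_mul_I, one_mul, Complex.norm_real,
        Real.norm_of_nonneg (Finset.prod_nonneg fun i _ => (truncExpDensity_pos hμ _).le), mul_comm]
  calc _ = ∫ x : Fin n → ℝ, ∫ ξ : ℝ,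
        Complex.exp ((2 * π * ξ * (n * α + δ - ∑ i, x i) : ℝ) * Complex.I) * rampExpFourier μ ξ *
          ((∏ i, truncExpDensity μ (x i) : ℝ) : ℂ) ∂volume ∂ρ := by
        rw [← integral_complex_ofReal]
        congr 1
        ext x
        rw [integral_mul_const, ← rampExp_eq_integral hμ]
        push_cast; rfl
    _ = _ := by
        rw [integral_integral_swap hint]
        congr 1
        ext ξ
        have h : ∀ x : Fin n → ℝ,
            Complex.exp ((2 * π * ξ * (n * α + δ - ∑ i, x i) : ℝ) * Complex.I) *
              rampExpFourier μ ξ * ((∏ i, truncExpDensity μ (x i) : ℝ) : ℂ) =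
            Complex.exp ((2 * π * ξ * δ : ℝ) * Complex.I) * rampExpFourier μ ξ *
              ∏ i, (Complex.exp ((-(2 * π * ξ) * (x i - α) : ℝ) * Complex.I) *
                (truncExpDensity μ (x i) : ℂ)) := by
          intro x
          rw [Finset.prod_mul_distrib, ← Complex.exp_sum, Complex.ofReal_prod]
          have : Complex.exp ((2 * π * ξ * (n * α + δ - ∑ i, x i) : ℝ) * Complex.I) =
              Complex.exp ((2 * π * ξ * δ : ℝ) * Complex.I) *
              Complex.exp (∑ i, ((-(2 * π * ξ) * (x i - α) : ℝ) * Complex.I)) := by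
            rw [← Complex.exp_add, ← Finset.sum_mul, ← Complex.ofReal_sum, ← Finset.mul_sum,
              Finset.sum_sub_distrib, ← add_mul, ← Complex.ofReal_add]
            congr 3
            simp
            ring
          rw [this]
          ring
        simp_rw [h]
        rw [integral_const_mul, hρ, integral_fintype_prod_eq_pow (ι := Fin n) (fun y : ℝ =>
          Complex.exp ((-(2 * π * ξ) * (y - α) : ℝ) * Complex.I) * (truncExpDensity μ y : ℂ)),
          Fintype.card_fin]
        rfl

/-- Local limit theorem for truncated exponential variables, tested against `rampExp`. -/
lemma tendsto_sqrt_mul_integral_rampExp {μ α : ℝ} (hμ : 0 < μ)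
    (hα : α = 1 / μ - 1 / (Real.exp μ - 1)) (δ : ℝ) :
    Tendsto (fun n : ℕ => √n * ∫ x : Fin n → ℝ, rampExp μ (n * α + δ - ∑ i, x i) *
        ∏ i, truncExpDensity μ (x i) ∂Measure.pi fun _ => volume.restrict (Set.Icc (0 : ℝ) 1))
      atTop (𝓝 (1 / (μ ^ 2 * √(2 * π * truncExpVariance μ)))) := by
  have hv := truncExpVariance_pos hμ
  set σ := √(truncExpVariance μ) with hσ
  have hσ0 : 0 < σ := Real.sqrt_pos.2 hv
  obtain ⟨k, hk, hψ⟩ := exists_norm_truncExpCharFun_le hμ α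
  set G : ℕ → ℝ → ℂ := fun n t =>
    Complex.exp ((2 * π * (-(1 / (2 * π * σ * √n)) * t) * δ : ℝ) * Complex.I) *
      rampExpFourier μ (-(1 / (2 * π * σ * √n)) * t) *
      truncExpCharFun μ α ((√n)⁻¹ * t / σ) ^ n with hG
  have hscale : ∀ n : ℕ, 1 ≤ n → ((√n * ∫ x : Fin n → ℝ, rampExp μ (n * α + δ - ∑ i, x i) *
        ∏ i, truncExpDensity μ (x i) ∂Measure.pi fun _ => volume.restrict (Set.Icc (0 : ℝ) 1) : ℝ)
        : ℂ) = (1 / (2 * π * σ) : ℝ) * ∫ t, G n t := by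
    intro n hn
    have hn' : 0 < √(n : ℝ) := Real.sqrt_pos.2 (by exact_mod_cast hn)
    rw [Complex.ofReal_mul, integral_rampExp_pi hμ]
    have h := Measure.integral_comp_mul_left (fun ξ : ℝ =>
      Complex.exp ((2 * π * ξ * δ : ℝ) * Complex.I) * rampExpFourier μ ξ *
        truncExpCharFun μ α (-(2 * π * ξ)) ^ n) (-(1 / (2 * π * σ * √n)))
    have hGn : ∀ t, G n t = Complex.exp ((2 * π * (-(1 / (2 * π * σ * √n)) * t) * δ : ℝ) *
        Complex.I) * rampExpFourier μ (-(1 / (2 * π * σ * √n)) * t) *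
        truncExpCharFun μ α (-(2 * π * (-(1 / (2 * π * σ * √n)) * t))) ^ n := by
      intro t
      simp only [hG]
      congr 3
      field_simp
    simp_rw [hGn]
    rw [h, Complex.real_smul, ← mul_assoc, ← Complex.ofReal_mul]
    congr 2
    rw [inv_neg, abs_neg, abs_of_pos (by positivity)]
    field_simp
  have hlim : Tendsto (fun n : ℕ => ∫ t, G n t) atTop
      (𝓝 (∫ t : ℝ, ((μ ^ 2)⁻¹ : ℂ) * Complex.exp (-t ^ 2 / 2))) := by
    have hinv : Tendsto (fun n : ℕ => (√(n : ℝ))⁻¹) atTop (𝓝 0) :=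
      tendsto_inv_atTop_zero.comp (Real.tendsto_sqrt_atTop.comp tendsto_natCast_atTop_atTop)
    refine tendsto_integral_filter_of_dominated_convergence (fun t : ℝ =>
      (μ ^ 2)⁻¹ * Real.exp (-(k / σ ^ 2) * t ^ 2) + k⁻¹ * (μ ^ 2 + (σ⁻¹ * t) ^ 2)⁻¹) ?_ ?_ ?_ ?_
    · refine Eventually.of_forall fun n => ?_
      have h1 := continuous_rampExpFourier hμ
      have h2 := continuous_truncExpCharFun hμ α
      refine Continuous.aestronglyMeasurable ?_
      simp only [hG]
      fun_prop
    · filter_upwards [eventually_ge_atTop 1] with n hn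
      refine Eventually.of_forall fun t => ?_
      have hn1 : (1 : ℝ) ≤ n := by exact_mod_cast hn
      have hn0 : (0 : ℝ) < n := one_pos.trans_le hn1
      have hsn : √(n : ℝ) ^ 2 = n := Real.sq_sqrt hn0.le
      have hsn0 : 0 < √(n : ℝ) := Real.sqrt_pos.2 hn0
      simp only [hG]
      rw [norm_mul, norm_mul, Complex.norm_exp_ofReal_mul_I, one_mul, norm_pow,
        norm_rampExpFourier]
      have hψn := norm_truncExpCharFun_pow_le hψ ((√n)⁻¹ * t / σ) n
      have hs : (n : ℝ) * ((√n)⁻¹ * t / σ) ^ 2 = t ^ 2 / σ ^ 2 := by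
        rw [div_pow, mul_pow, inv_pow, hsn]; field_simp
      have hy : (2 * π * (-(1 / (2 * π * σ * √n)) * t)) ^ 2 = (σ⁻¹ * t) ^ 2 / n := by
        calc _ = (σ⁻¹ * t) ^ 2 / √n ^ 2 := by field_simp
          _ = _ := by rw [hsn]
      rw [hs] at hψn
      rw [hy]
      have h1 : (μ ^ 2 + (σ⁻¹ * t) ^ 2 / n)⁻¹ ≤ (μ ^ 2)⁻¹ :=
        inv_anti₀ (by positivity) (le_add_of_nonneg_right (by positivity))
      have h2 : (μ ^ 2 + (σ⁻¹ * t) ^ 2 / n)⁻¹ ≤ n * (μ ^ 2 + (σ⁻¹ * t) ^ 2)⁻¹ := by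
        rw [inv_le_iff_one_le_mul₀ (by positivity), mul_right_comm, ← div_eq_mul_inv,
          one_le_div (by positivity), mul_add, mul_div_cancel₀ _ hn0.ne']
        nlinarith [sq_nonneg μ]
      have h3 : (n : ℝ) * Real.exp (-k * n) ≤ k⁻¹ := by
        rw [neg_mul, Real.exp_neg, ← div_eq_mul_inv, div_le_iff₀ (Real.exp_pos _),
          inv_mul_eq_div, le_div_iff₀ hk]
        linarith [Real.add_one_le_exp (k * n)]
      calc _ ≤ (μ ^ 2 + (σ⁻¹ * t) ^ 2 / n)⁻¹ *
            (Real.exp (-k * (t ^ 2 / σ ^ 2)) + Real.exp (-k * n)) := by gcongr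
        _ = (μ ^ 2 + (σ⁻¹ * t) ^ 2 / n)⁻¹ * Real.exp (-k * (t ^ 2 / σ ^ 2)) +
            (μ ^ 2 + (σ⁻¹ * t) ^ 2 / n)⁻¹ * Real.exp (-k * n) := mul_add _ _ _
        _ ≤ (μ ^ 2)⁻¹ * Real.exp (-k * (t ^ 2 / σ ^ 2)) +
            n * (μ ^ 2 + (σ⁻¹ * t) ^ 2)⁻¹ * Real.exp (-k * n) := by gcongr
        _ = (μ ^ 2)⁻¹ * Real.exp (-(k / σ ^ 2) * t ^ 2) +
            n * Real.exp (-k * n) * (μ ^ 2 + (σ⁻¹ * t) ^ 2)⁻¹ := by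
          congr 1
          · congr 2; ring
          · ring
        _ ≤ _ := by gcongr
    · exact ((integrable_exp_neg_mul_sq (by positivity)).const_mul _).add
        ((integrable_inv_sq_add_sq hμ (by positivity)).const_mul _)
    · refine Eventually.of_forall fun t => ?_
      have hb : Tendsto (fun n : ℕ => -(1 / (2 * π * σ * √n)) * t) atTop (𝓝 0) := by
        have := hinv.const_mul (-(1 / (2 * π * σ)) * t)
        rw [mul_zero] at this
        refine this.congr fun n => ?_
        ring
      have h1 : Tendsto (fun n : ℕ => Complex.exp
          ((2 * π * (-(1 / (2 * π * σ * √n)) * t) * δ : ℝ) * Complex.I)) atTop (𝓝 1) := by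
        have hc : Continuous fun y : ℝ => Complex.exp ((2 * π * y * δ : ℝ) * Complex.I) := by
          fun_prop
        have := (hc.tendsto 0).comp hb
        simpa [Function.comp_def] using this
      have h2 : Tendsto (fun n : ℕ => rampExpFourier μ (-(1 / (2 * π * σ * √n)) * t)) atTop
          (𝓝 ((μ ^ 2)⁻¹ : ℂ)) := by
        have := ((continuous_rampExpFourier hμ).tendsto 0).comp hb
        simpa [Function.comp_def, rampExpFourier] using this
      have := (h1.mul h2).mul (tendsto_truncExpCharFun_pow hμ hα t)
      rwa [one_mul] at this
  have hval : ((1 / (2 * π * σ) : ℝ) : ℂ) * (∫ t : ℝ, ((μ ^ 2)⁻¹ : ℂ) * Complex.exp (-t ^ 2 / 2)) =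
      ((1 / (μ ^ 2 * √(2 * π * truncExpVariance μ)) : ℝ) : ℂ) := by
    have h := integral_gaussian (1 / 2)
    have h' : ∀ t : ℝ, ((μ ^ 2)⁻¹ : ℂ) * Complex.exp (-t ^ 2 / 2) =
        (((μ ^ 2)⁻¹ * Real.exp (-(1 / 2) * t ^ 2) : ℝ) : ℂ) := by
      intro t; push_cast; ring_nf
    simp_rw [h']
    rw [integral_complex_ofReal, integral_const_mul, h, ← Complex.ofReal_mul]
    congr 1
    rw [Real.sqrt_mul (by positivity) (truncExpVariance μ), ← hσ,
      show π / (1 / 2) = 2 * π by ring]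
    have : √(2 * π) ^ 2 = 2 * π := Real.sq_sqrt (by positivity)
    have h0 : 0 < √(2 * π) := Real.sqrt_pos.2 (by positivity)
    field_simp
    linear_combination this
  have h := (hlim.const_mul ((1 / (2 * π * σ) : ℝ) : ℂ))
  rw [hval] at h
  refine ((Complex.continuous_re.tendsto _).comp h).congr' ?_
  filter_upwards [eventually_ge_atTop 1] with n hn
  rw [Function.comp, ← hscale n hn, Complex.ofReal_re]

/-- If convex monotone functions `F n` converge pointwise to `C e^{μ y}`, then the slopes of their
tangent lines through the origin converge to the slope of the tangent line of the limit. -/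
lemma tendsto_slope_of_tangent_through_origin {F : ℕ → ℝ → ℝ} {C μ : ℝ} (hC : 0 < C) (hμ : 0 < μ)
    (hconv : ∀ n, ConvexOn ℝ Set.univ (F n)) (hmono : ∀ n, Monotone (F n))
    (hlim : ∀ y, Tendsto (fun n => F n y) atTop (𝓝 (C * Real.exp (μ * y)))) {δ G : ℕ → ℝ}
    (hδ : ∀ᶠ n in atTop, 0 < δ n) (hFG : ∀ᶠ n in atTop, F n (δ n) = δ n * G n)
    (htan : ∀ᶠ n in atTop, ∀ y, y * G n ≤ F n y) :
    Tendsto G atTop (𝓝 (C * μ * Real.exp 1)) := by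
  have hx : (0 : ℝ) < 1 / μ := by positivity
  have hlimx := hlim (1 / μ)
  rw [mul_one_div_cancel hμ.ne'] at hlimx
  have habove : ∀ y, y ≠ 1 / μ → ∀ᶠ n in atTop, y * (μ * F n (1 / μ)) < F n y := by
    intro y hy
    refine ((hlimx.const_mul μ).const_mul y).eventually_lt (hlim y) ?_
    have hne : μ * y - 1 ≠ 0 := by
      intro h
      apply hy
      field_simp
      linarith
    have h1 := Real.add_one_lt_exp hne
    have h2 : Real.exp (μ * y) = Real.exp (μ * y - 1) * Real.exp 1 := by
      rw [← Real.exp_add]; congr 1; ring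
    calc y * (μ * (C * Real.exp 1)) = C * ((μ * y - 1 + 1) * Real.exp 1) := by ring
      _ < C * (Real.exp (μ * y - 1) * Real.exp 1) := by gcongr
      _ = _ := by rw [h2]
  have hbelow : ∀ᶠ n in atTop, ∀ y, (y ∈ Set.Icc (δ n) (1 / μ) ∨ y ∈ Set.Icc (1 / μ) (δ n)) →
      F n y ≤ y * (μ * F n (1 / μ)) := by
    filter_upwards [hδ, hFG, htan] with n h1 h2 h3 y hy
    set a := μ * F n (1 / μ) with ha
    have hg : ConvexOn ℝ Set.univ (fun z => F n z + (-a) * z) :=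
      (hconv n).add ((LinearMap.mul ℝ ℝ (-a)).convexOn convex_univ)
    have hgx : F n (1 / μ) + (-a) * (1 / μ) = 0 := by rw [ha]; field_simp; ring
    have hGa : G n ≤ a := by
      have := h3 (1 / μ)
      rw [ha]
      rw [one_div, inv_mul_le_iff₀ hμ] at this
      simpa using this
    have hgδ : F n (δ n) + (-a) * δ n ≤ 0 := by
      rw [h2]; nlinarith
    have : F n y + (-a) * y ≤ 0 := by
      rcases hy with hy | hy
      · exact (hg.le_max_of_mem_Icc (Set.mem_univ _) (Set.mem_univ _) hy).trans
          (max_le hgδ hgx.le)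
      · exact (hg.le_max_of_mem_Icc (Set.mem_univ _) (Set.mem_univ _) hy).trans
          (max_le hgx.le hgδ)
    linarith
  have hδlim : Tendsto δ atTop (𝓝 (1 / μ)) := by
    rw [tendsto_order]
    constructor
    · intro a ha
      filter_upwards [habove a ha.ne, hbelow] with n h1 h2
      by_contra! h
      exact absurd (h2 a (Or.inl ⟨h, ha.le⟩)) (not_le.2 h1)
    · intro a ha
      filter_upwards [habove a ha.ne', hbelow] with n h1 h2
      by_contra! h
      exact absurd (h2 a (Or.inr ⟨ha.le, h⟩)) (not_le.2 h1)
  have hcont : Tendsto (fun y => C * Real.exp (μ * y)) (𝓝 (1 / μ)) (𝓝 (C * Real.exp 1)) := by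
    have : Continuous fun y => C * Real.exp (μ * y) := by fun_prop
    have h := this.tendsto (1 / μ)
    rwa [mul_one_div_cancel hμ.ne'] at h
  have hFδ : Tendsto (fun n => F n (δ n)) atTop (𝓝 (C * Real.exp 1)) := by
    rw [tendsto_order]
    constructor
    · intro a ha
      obtain ⟨y, hy, hyx⟩ := (((hcont.mono_left nhdsWithin_le_nhds).eventually
        (lt_mem_nhds ha)).and (self_mem_nhdsWithin (s := Set.Iio (1 / μ)))).exists
      filter_upwards [(hlim y).eventually (lt_mem_nhds hy), hδlim.eventually (lt_mem_nhds hyx)]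
        with n h1 h2
      exact h1.trans_le (hmono n h2.le)
    · intro a ha
      obtain ⟨y, hy, hyx⟩ := (((hcont.mono_left nhdsWithin_le_nhds).eventually
        (gt_mem_nhds ha)).and (self_mem_nhdsWithin (s := Set.Ioi (1 / μ)))).exists
      filter_upwards [(hlim y).eventually (gt_mem_nhds hy), hδlim.eventually (gt_mem_nhds hyx)]
        with n h1 h2
      exact (hmono n h2.le).trans_lt h1
  have h := hFδ.div hδlim hx.ne'
  have hval : C * Real.exp 1 / (1 / μ) = C * μ * Real.exp 1 := by field_simp
  rw [hval] at h
  refine h.congr' ?_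
  filter_upwards [hδ, hFG] with n h1 h2
  rw [Pi.div_apply, h2, mul_div_cancel_left₀ _ h1.ne']

/-- Lebesgue measure on the unit cube. -/
noncomputable abbrev cubeMeasure (n : ℕ) : Measure (Fin n → ℝ) :=
  Measure.pi fun _ => volume.restrict (Set.Icc (0 : ℝ) 1)

lemma cubeMeasure_eq_restrict (n : ℕ) :
    cubeMeasure n = volume.restrict (Set.univ.pi fun _ : Fin n => Set.Icc (0 : ℝ) 1) := by
  rw [volume_pi, Measure.restrict_pi_pi]

lemma integrable_cubeMeasure {n : ℕ} {f : (Fin n → ℝ) → ℝ} (hf : Continuous f) :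
    Integrable f (cubeMeasure n) := by
  rw [cubeMeasure_eq_restrict]
  exact hf.continuousOn.integrableOn_compact (isCompact_univ_pi fun _ => isCompact_Icc)

lemma measurableSet_sum_le (n : ℕ) (t : ℝ) : MeasurableSet {x : Fin n → ℝ | ∑ i, x i ≤ t} :=
  measurableSet_le (by fun_prop) measurable_const

lemma restrict_truncCube (n : ℕ) (t : ℝ) :
    volume.restrict (truncCube n t) = (cubeMeasure n).restrict {x | ∑ i, x i ≤ t} := by
  rw [cubeMeasure_eq_restrict, Measure.restrict_restrict (measurableSet_sum_le n t)]
  congr 1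
  ext x
  simp only [truncCube, Set.mem_ofPred_eq, Set.mem_inter_iff, Set.mem_univ_pi]
  tauto

lemma truncVol_eq_measureReal (n : ℕ) (t : ℝ) :
    truncVol n t = (cubeMeasure n).real {x | ∑ i, x i ≤ t} := by
  have h := congrArg (fun m : Measure (Fin n → ℝ) => m Set.univ) (restrict_truncCube n t)
  simp only [Measure.restrict_apply_univ] at h
  rw [truncVol, h, Measure.real]

lemma setIntegral_sub_sum (n : ℕ) (s t : ℝ) :
    ∫ x in {x : Fin n → ℝ | ∑ i, x i ≤ t}, (s - ∑ i, x i) ∂cubeMeasure n =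
      s * truncVol n t - ∫ x in truncCube n t, ∑ i, x i := by
  rw [integral_sub (integrable_const _) (integrable_cubeMeasure (by fun_prop)).integrableOn,
    restrict_truncCube, setIntegral_const, smul_eq_mul, truncVol_eq_measureReal, mul_comm]

/-- The integral over the unit cube of the positive part of `s - ∑ x i`. -/
noncomputable def rampIntegral (n : ℕ) (s : ℝ) : ℝ :=
  ∫ x : Fin n → ℝ, max (s - ∑ i, x i) 0 ∂cubeMeasure n

lemma integrable_ramp (n : ℕ) (s : ℝ) :
    Integrable (fun x : Fin n → ℝ => max (s - ∑ i, x i) 0) (cubeMeasure n) :=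
  integrable_cubeMeasure (by fun_prop)

lemma rampIntegral_nonneg (n : ℕ) (s : ℝ) : 0 ≤ rampIntegral n s :=
  integral_nonneg fun _ => le_max_right _ _

lemma monotone_rampIntegral (n : ℕ) : Monotone (rampIntegral n) := fun s t h =>
  integral_mono (integrable_ramp n s) (integrable_ramp n t) fun _ => by
    dsimp only; gcongr

lemma convexOn_rampIntegral (n : ℕ) : ConvexOn ℝ Set.univ (rampIntegral n) := by
  refine ⟨convex_univ, fun s _ t _ a b ha hb hab => ?_⟩
  simp only [rampIntegral, smul_eq_mul]
  rw [← integral_const_mul, ← integral_const_mul,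
    ← integral_add ((integrable_ramp n s).const_mul a) ((integrable_ramp n t).const_mul b)]
  refine integral_mono (integrable_ramp n _)
    (((integrable_ramp n s).const_mul a).add ((integrable_ramp n t).const_mul b)) fun x => ?_
  dsimp only
  set y := ∑ i, x i
  have h1 := mul_le_mul_of_nonneg_left (le_max_left (s - y) 0) ha
  have h2 := mul_le_mul_of_nonneg_left (le_max_left (t - y) 0) hb
  refine max_le ?_ (by positivity)
  have : a * s + b * t - y = a * (s - y) + b * (t - y) := by
    linear_combination y * hab
  linarith

lemma rampIntegral_eq (n : ℕ) (t : ℝ) :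
    rampIntegral n t = t * truncVol n t - ∫ x in truncCube n t, ∑ i, x i := by
  rw [← setIntegral_sub_sum, ← integral_indicator (measurableSet_sum_le n t), rampIntegral]
  congr 1
  ext x
  by_cases h : ∑ i, x i ≤ t
  · rw [Set.indicator_of_mem (by exact h), max_eq_left (by linarith)]
  · rw [Set.indicator_of_notMem (by exact h), max_eq_right (by linarith)]

lemma le_rampIntegral (n : ℕ) (s t : ℝ) :
    s * truncVol n t - ∫ x in truncCube n t, ∑ i, x i ≤ rampIntegral n s := by
  rw [← setIntegral_sub_sum]
  calc _ ≤ ∫ x in {x : Fin n → ℝ | ∑ i, x i ≤ t}, max (s - ∑ i, x i) 0 ∂cubeMeasure n :=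
        integral_mono (integrable_cubeMeasure (by fun_prop)).integrableOn
          (integrable_ramp n s).integrableOn fun _ => le_max_left _ _
    _ ≤ _ := setIntegral_le_integral (integrable_ramp n s)
        (Eventually.of_forall fun _ => le_max_right _ _)

/-- The exponential normalisation of volumes of truncated cubes near the level `n α`. -/
noncomputable def truncVolScale (μ α : ℝ) (n : ℕ) : ℝ :=
  √n * ((μ / (1 - Real.exp (-μ))) ^ n * Real.exp (-μ * (n * α)))

lemma truncVolScale_mul_rampIntegral (μ α y : ℝ) (n : ℕ) :
    truncVolScale μ α n * rampIntegral n (n * α + y) =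
      (√n * ∫ x : Fin n → ℝ, rampExp μ (n * α + y - ∑ i, x i) * ∏ i, truncExpDensity μ (x i)
        ∂cubeMeasure n) * Real.exp (μ * y) := by
  have h : ∀ x : Fin n → ℝ,
      rampExp μ (n * α + y - ∑ i, x i) * ∏ i, truncExpDensity μ (x i) =
        (μ / (1 - Real.exp (-μ))) ^ n * Real.exp (-μ * (n * α + y)) *
          max (n * α + y - ∑ i, x i) 0 := by
    intro x
    simp only [truncExpDensity, rampExp]
    rw [Finset.prod_mul_distrib, Finset.prod_const, ← Real.exp_sum, Finset.card_univ,
      Fintype.card_fin, ← Finset.mul_sum]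
    have : Real.exp (-μ * (n * α + y)) =
        Real.exp (-μ * (n * α + y - ∑ i, x i)) * Real.exp (-μ * ∑ i, x i) := by
      rw [← Real.exp_add]; congr 1; ring
    rw [this]; ring
  simp_rw [h]
  rw [integral_const_mul, truncVolScale, rampIntegral]
  have : Real.exp (-μ * (n * α)) = Real.exp (-μ * (n * α + y)) * Real.exp (μ * y) := by
    rw [← Real.exp_add]; congr 1; ring
  rw [this]; ring

lemma truncVolScale_pos {μ : ℝ} (hμ : 0 < μ) (α : ℝ) {n : ℕ} (hn : 1 ≤ n) :
    0 < truncVolScale μ α n := by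
  have hn' : 0 < √(n : ℝ) := Real.sqrt_pos.2 (by exact_mod_cast hn)
  have := one_sub_exp_neg_pos hμ
  unfold truncVolScale
  positivity

lemma truncVolScale_nonneg {μ : ℝ} (hμ : 0 < μ) (α : ℝ) (n : ℕ) : 0 ≤ truncVolScale μ α n := by
  have := one_sub_exp_neg_pos hμ
  unfold truncVolScale
  positivity

lemma log_truncVolScale {μ : ℝ} (hμ : 0 < μ) (α : ℝ) {n : ℕ} (hn : 1 ≤ n) :
    Real.log (truncVolScale μ α n) =
      Real.log n / 2 - n * (μ * α - Real.log (μ / (1 - Real.exp (-μ)))) := by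
  have hn' : (0 : ℝ) < n := by exact_mod_cast hn
  have hs : 0 < √(n : ℝ) := Real.sqrt_pos.2 hn'
  have := div_pos hμ (one_sub_exp_neg_pos hμ)
  rw [truncVolScale, Real.log_mul hs.ne' (by positivity),
    Real.log_mul (by positivity) (by positivity), Real.log_pow, Real.log_exp, Real.log_sqrt hn'.le]
  ring

lemma truncVol_pos_of_truncMoment_ne_zero {n : ℕ} {t : ℝ} (h : truncMoment n t ≠ 0) :
    0 < truncVol n t := by
  refine lt_of_le_of_ne ENNReal.toReal_nonneg fun h0 => h ?_
  rw [truncMoment, ← h0]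
  simp

lemma setIntegral_truncCube_eq {n : ℕ} (hn : 1 ≤ n) {t α : ℝ} (hα : α ≠ 0)
    (h : truncMoment n t = α) :
    ∫ x in truncCube n t, ∑ i, x i = n * α * truncVol n t := by
  have hV := truncVol_pos_of_truncMoment_ne_zero (h ▸ hα)
  have hn' : (0 : ℝ) < n := by exact_mod_cast hn
  rw [← h, truncMoment]
  field_simp

lemma tendsto_truncVolScale_mul_truncVol {α μ : ℝ} (hα : 0 < α) (hμ : 0 < μ)
    (hμeq : α = 1 / μ - 1 / (Real.exp μ - 1)) {t : ℕ → ℝ}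
    (ht : ∀ n : ℕ, 1 ≤ n → truncMoment n (t n) = α) :
    Tendsto (fun n => truncVolScale μ α n * truncVol n (t n)) atTop
      (𝓝 (1 / (μ ^ 2 * √(2 * π * truncExpVariance μ)) * μ * Real.exp 1)) := by
  have hv := truncExpVariance_pos hμ
  have hC : 0 < 1 / (μ ^ 2 * √(2 * π * truncExpVariance μ)) := by positivity
  have hlim : ∀ y, Tendsto (fun n : ℕ => truncVolScale μ α n * rampIntegral n (n * α + y)) atTop
      (𝓝 (1 / (μ ^ 2 * √(2 * π * truncExpVariance μ)) * Real.exp (μ * y))) := by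
    intro y
    simp_rw [truncVolScale_mul_rampIntegral]
    exact (tendsto_sqrt_mul_integral_rampExp hμ hμeq y).mul_const _
  have hFG : ∀ᶠ n : ℕ in atTop, truncVolScale μ α n * rampIntegral n (n * α + (t n - n * α)) =
      (t n - n * α) * (truncVolScale μ α n * truncVol n (t n)) := by
    filter_upwards [eventually_ge_atTop 1] with n hn
    rw [add_sub_cancel, rampIntegral_eq, setIntegral_truncCube_eq hn hα.ne' (ht n hn)]
    ring
  refine tendsto_slope_of_tangent_through_origin (δ := fun n => t n - n * α)
    (F := fun n y => truncVolScale μ α n * rampIntegral n (n * α + y)) hC hμ ?_ ?_ hlim ?_ hFG ?_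
  · intro n
    have := (convexOn_rampIntegral n).translate_right (c := (n * α : ℝ))
    exact (by simpa [Function.comp_def] using this.smul (truncVolScale_nonneg hμ α n))
  · intro n y z hyz
    have := monotone_rampIntegral n (add_le_add_right hyz (n * α : ℝ))
    exact mul_le_mul_of_nonneg_left this (truncVolScale_nonneg hμ α n)
  · have h0 := (hlim 0).eventually (lt_mem_nhds (mul_pos hC (Real.exp_pos (μ * 0))))
    filter_upwards [hFG, h0, eventually_ge_atTop 1] with n h1 h2 hn
    have hV := truncVol_pos_of_truncMoment_ne_zero ((ht n hn).symm ▸ hα.ne')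
    have hK := truncVolScale_pos hμ α hn
    have hnn : 0 ≤ (t n - n * α) * (truncVolScale μ α n * truncVol n (t n)) :=
      h1 ▸ mul_nonneg hK.le (rampIntegral_nonneg n _)
    refine lt_of_le_of_ne (nonneg_of_mul_nonneg_left hnn (mul_pos hK hV)) fun h => ?_
    rw [← h, zero_mul] at h1
    exact h2.ne' h1
  · filter_upwards [eventually_ge_atTop 1] with n hn y
    have h := le_rampIntegral n (n * α + y) (t n)
    rw [setIntegral_truncCube_eq hn hα.ne' (ht n hn)] at h
    have h' := mul_le_mul_of_nonneg_left h (truncVolScale_nonneg hμ α n)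
    refine le_trans (le_of_eq ?_) h'
    ring

theorem max_shaping_gain_second_order_asymptotics
    (α : ℝ) (hα : α ∈ Set.Ioo (0 : ℝ) (1 / 2))
    (μ : ℝ) (hμ : 0 < μ) (hμeq : α = 1 / μ - 1 / (Real.exp μ - 1))
    (t : ℕ → ℝ)
    (ht : ∀ n : ℕ, 1 ≤ n → t n ∈ Set.Ioo (0 : ℝ) n ∧ truncMoment n (t n) = α)
    (hmax ω : ℝ)
    (hhmax : hmax = μ * α - Real.log (μ / (1 - Real.exp (-μ))))
    (hω : ω = 1 - (1 / 2) *
        Real.log (2 * Real.pi * (-μ + 2 * α * μ + μ ^ 2 * α * (1 - α)))) :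
    (fun n : ℕ =>
        (1 / (n : ℝ)) * Real.log (truncVol n (t n)) -
          (hmax - Real.log n / (2 * n) + ω / n))
      =o[atTop] (fun n : ℕ => 1 / (n : ℝ)) ∧
    (fun n : ℕ =>
        Real.log (truncVol n (t n) ^ ((1 : ℝ) / n) / (2 * α)) -
          (hmax - Real.log (2 * α) - Real.log n / (2 * n) + ω / n))
      =o[atTop] (fun n : ℕ => 1 / (n : ℝ)) := by
  have hv := truncExpVariance_pos hμ
  have hV : ∀ n : ℕ, 1 ≤ n → 0 < truncVol n (t n) := fun n hn =>
    truncVol_pos_of_truncMoment_ne_zero ((ht n hn).2.symm ▸ hα.1.ne')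
  have hC : 0 < 1 / (μ ^ 2 * √(2 * π * truncExpVariance μ)) * μ * Real.exp 1 := by positivity
  have hω' : Real.log (1 / (μ ^ 2 * √(2 * π * truncExpVariance μ)) * μ * Real.exp 1) = ω := by
    rw [hω, ← sq_mul_truncExpVariance hμ hμeq]
    have h1 : 1 / (μ ^ 2 * √(2 * π * truncExpVariance μ)) * μ * Real.exp 1 =
        Real.exp 1 / √(2 * π * (μ ^ 2 * truncExpVariance μ)) := by
      rw [show 2 * π * (μ ^ 2 * truncExpVariance μ) = μ ^ 2 * (2 * π * truncExpVariance μ) by ring,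
        Real.sqrt_mul (sq_nonneg μ) (2 * π * truncExpVariance μ), Real.sqrt_sq hμ.le]
      field_simp
    rw [h1, Real.log_div (by positivity) (by positivity), Real.log_exp,
      Real.log_sqrt (by positivity)]
    ring
  have hlog := (tendsto_truncVolScale_mul_truncVol hα.1 hμ hμeq fun n hn => (ht n hn).2).log hC.ne'
  rw [hω'] at hlog
  have hfirst : (fun n : ℕ => (1 / (n : ℝ)) * Real.log (truncVol n (t n)) -
      (hmax - Real.log n / (2 * n) + ω / n)) =o[atTop] (fun n : ℕ => 1 / (n : ℝ)) := by
    rw [isLittleO_iff_tendsto' ?_]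
    · have h := hlog.sub_const ω
      rw [sub_self] at h
      refine h.congr' ?_
      filter_upwards [eventually_ge_atTop 1] with n hn
      have hn' : (0 : ℝ) < n := by exact_mod_cast hn
      rw [Real.log_mul (truncVolScale_pos hμ α hn).ne' (hV n hn).ne', log_truncVolScale hμ α hn,
        ← hhmax]
      field_simp
      ring
    · filter_upwards [eventually_ge_atTop 1] with n hn h
      have hn' : (0 : ℝ) < n := by exact_mod_cast hn
      exact absurd h (by positivity)
  refine ⟨hfirst, hfirst.congr' ?_ EventuallyEq.rfl⟩
  filter_upwards [eventually_ge_atTop 1] with n hn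
  have hVn := hV n hn
  rw [Real.log_div (by positivity) (by linarith [hα.1]), Real.log_rpow hVn]
  ring
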